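/- arXiv:2106.15427 — 2 statements merged into one kernel-verified Lean document; each statement's English description precedes it below -/
import Mathlib

section
/- For any $p \in [1,\infty)$, $d \in \mathbb{N}^*$, and probability measures $\mu, \nu$ on $\mathbb{R}^d$ with finite $p$-th moments, the Sliced-Wasserstein distance with Gaussian projections satisfies $\widetilde{SW}_p(\mu,\nu) = (2/d)^{1/2} \left( \Gamma(d/2 + p/2) / \Gamma(d/2) \right)^{1/p} SW_p(\mu,\nu)$, where $\widetilde{SW}_p^p(\mu,\nu) = \int_{\mathbb{R}^d} W_p^p(\theta^\star_\sharp \mu, \theta^\star_\sharp \nu) \, d\boldsymbol{\gamma}_d(\theta)$ with $\boldsymbol{\gamma}_d = \mathrm{N}(0, (1/d)\mathbf{I}_d)$, and $SW_p^p(\mu,\nu) = \int_{\mathbb{S}^{d-1}} W_p^p(\theta^\star_\sharp \mu, \theta^\star_\sharp \nu) \, d\boldsymbol{\sigma}(\theta)$ with $\boldsymbol{\sigma}$ the uniform measure on the unit sphere. -/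
open MeasureTheory Metric ProbabilityTheory
open scoped RealInnerProductSpace NNReal

/-- `p`-th power of the Wasserstein distance of order `p` between two
probability measures on `ℝ`. -/
noncomputable def WpPow (p : ℝ) (μ ν : Measure ℝ) : ℝ :=
  sInf {c : ℝ | ∃ γ : Measure (ℝ × ℝ), IsProbabilityMeasure γ ∧
    γ.map Prod.fst = μ ∧ γ.map Prod.snd = ν ∧ c = ∫ z, |z.1 - z.2| ^ p ∂γ}

/-- The uniform probability measure on the unit sphere `𝕊^{d-1} ⊆ ℝ^d`. -/
noncomputable def sphereUniform (d : ℕ) :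
    Measure (sphere (0 : EuclideanSpace ℝ (Fin d)) 1) :=
  ((volume : Measure (EuclideanSpace ℝ (Fin d))).toSphere Set.univ)⁻¹ •
    (volume : Measure (EuclideanSpace ℝ (Fin d))).toSphere

/-- The Gaussian measure on `ℝ^d` with mean `m` and covariance `v • I`. -/
noncomputable def gaussianPi (d : ℕ) (m : Fin d → ℝ) (v : ℝ≥0) :
    Measure (EuclideanSpace ℝ (Fin d)) :=
  Measure.map (⇑(EuclideanSpace.equiv (Fin d) ℝ).symm)
    (Measure.pi fun i => gaussianReal (m i) v)

/-- `p`-th power of the Sliced-Wasserstein distance of order `p`. -/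
noncomputable def SWPow (p : ℝ) {d : ℕ} (μ ν : Measure (EuclideanSpace ℝ (Fin d))) : ℝ :=
  ∫ θ : sphere (0 : EuclideanSpace ℝ (Fin d)) 1,
    WpPow p (μ.map fun x => ⟪(θ : EuclideanSpace ℝ (Fin d)), x⟫)
      (ν.map fun x => ⟪(θ : EuclideanSpace ℝ (Fin d)), x⟫) ∂(sphereUniform d)

/-- `p`-th power of the Sliced-Wasserstein distance of order `p` with Gaussian
projection directions drawn from `N(0, (1/d) I_d)`. -/
noncomputable def tSWPow (p : ℝ) {d : ℕ} (μ ν : Measure (EuclideanSpace ℝ (Fin d))) : ℝ :=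
  ∫ θ, WpPow p (μ.map fun x => ⟪θ, x⟫) (ν.map fun x => ⟪θ, x⟫)
    ∂(gaussianPi d 0 (1 / d))

/-- A finite product of measures with integrable real densities has the product density. -/
lemma MeasureTheory.Measure.pi_withDensity_ofReal {ι : Type*} [Fintype ι] {X : ι → Type*}
    [∀ i, MeasurableSpace (X i)] (μ : ∀ i, Measure (X i)) [∀ i, SigmaFinite (μ i)]
    (f : ∀ i, X i → ℝ) (hf : ∀ i, Integrable (f i) (μ i)) (hf₀ : ∀ i x, 0 ≤ f i x) :
    Measure.pi (fun i => (μ i).withDensity fun x => ENNReal.ofReal (f i x)) =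
      (Measure.pi μ).withDensity fun x => ENNReal.ofReal (∏ i, f i (x i)) := by
  have (i : ι) : SigmaFinite ((μ i).withDensity fun x => ENNReal.ofReal (f i x)) :=
    SigmaFinite.withDensity_ofReal _
  refine Measure.pi_eq fun s hs => ?_
  rw [withDensity_apply _ (MeasurableSet.univ_pi hs), Measure.restrict_pi_pi,
    ← ofReal_integral_eq_lintegral_ofReal
      (Integrable.fintype_prod_dep fun i => (hf i).restrict)
      (ae_of_all _ fun x => Finset.prod_nonneg fun i _ => hf₀ i (x i)),
    integral_fintype_prod_eq_prod,
    ENNReal.ofReal_prod_of_nonneg fun i _ => integral_nonneg (hf₀ i)]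
  refine Finset.prod_congr rfl fun i _ => ?_
  rw [withDensity_apply _ (hs i), ofReal_integral_eq_lintegral_ofReal (hf i).restrict
    (ae_of_all _ (hf₀ i))]

/-- Integration against a centered isotropic Gaussian, in terms of its Lebesgue density. -/
lemma integral_gaussianPi_zero (d : ℕ) {v : ℝ≥0} (hv : v ≠ 0)
    (f : EuclideanSpace ℝ (Fin d) → ℝ) :
    ∫ x, f x ∂(gaussianPi d 0 v) =
      ∫ x, ((√(2 * Real.pi * v))⁻¹ ^ d * Real.exp (-‖x‖ ^ 2 / (2 * v))) * f x := by
  have hdens (y : Fin d → ℝ) : ∏ i, gaussianPDFReal 0 v (y i) =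
      (√(2 * Real.pi * v))⁻¹ ^ d * Real.exp (-‖WithLp.toLp 2 y‖ ^ 2 / (2 * v)) := by
    simp [gaussianPDFReal, Finset.prod_mul_distrib, ← Real.exp_sum, EuclideanSpace.norm_sq_eq,
      Finset.sum_div, neg_div]
  have hpi : Measure.pi (fun i : Fin d => gaussianReal ((0 : Fin d → ℝ) i) v) =
      volume.withDensity fun y => ENNReal.ofReal (∏ i, gaussianPDFReal 0 v (y i)) := by
    simp_rw [gaussianReal_of_var_ne_zero _ hv]
    exact Measure.pi_withDensity_ofReal _ _ (fun _ => integrable_gaussianPDFReal 0 v)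
      fun _ => gaussianPDFReal_nonneg 0 v
  have hmeas : Measurable fun y : Fin d → ℝ => ∏ i, gaussianPDFReal 0 v (y i) := by
    refine Finset.measurable_prod _ fun i _ => ?_
    exact (measurable_gaussianPDFReal 0 v).comp (measurable_pi_apply i)
  have hemb : MeasurableEmbedding (⇑(EuclideanSpace.equiv (Fin d) ℝ).symm) :=
    (EuclideanSpace.equiv (Fin d) ℝ).symm.toHomeomorph.measurableEmbedding
  rw [gaussianPi, hemb.integral_map, hpi,
    integral_withDensity_eq_integral_toReal_smul hmeas.ennreal_ofReal
      (ae_of_all _ fun _ => ENNReal.ofReal_lt_top),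
    ← (PiLp.volume_preserving_toLp (Fin d)).integral_comp
      (MeasurableEquiv.toLp 2 (Fin d → ℝ)).measurableEmbedding]
  refine integral_congr_ae (ae_of_all _ fun y => ?_)
  simp only [smul_eq_mul]
  rw [ENNReal.toReal_ofReal (Finset.prod_nonneg fun i _ => gaussianPDFReal_nonneg 0 v _), hdens]
  rfl

/-- Polar coordinates for the product of a radial function and a positively homogeneous one. -/
lemma integral_radial_mul_homogeneous {E : Type*} [NormedAddCommGroup E] [NormedSpace ℝ E]
    [FiniteDimensional ℝ E] [MeasurableSpace E] [BorelSpace E] [Nontrivial E]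
    (μ : Measure E) [μ.IsAddHaarMeasure] (g : ℝ → ℝ) (f : E → ℝ) (q : ℝ)
    (hf : ∀ r : ℝ, 0 < r → ∀ x, f (r • x) = r ^ q * f x) :
    ∫ x, g ‖x‖ * f x ∂μ = (∫ s : sphere (0 : E) 1, f s ∂μ.toSphere) *
      ∫ r in Set.Ioi (0 : ℝ), r ^ (Module.finrank ℝ E - 1) * (g r * r ^ q) :=
  calc
    ∫ x, g ‖x‖ * f x ∂μ = ∫ x : ({(0)}ᶜ : Set E), g ‖x.1‖ * f x ∂(μ.comap (↑)) := by
      rw [integral_subtype_comap (measurableSet_singleton _).compl fun x ↦ g ‖x‖ * f x,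
        restrict_compl_singleton]
    _ = ∫ z, f z.1 * (g z.2 * (z.2 : ℝ) ^ q)
          ∂μ.toSphere.prod (.volumeIoiPow (Module.finrank ℝ E - 1)) := by
      rw [← μ.measurePreserving_homeomorphUnitSphereProd.integral_comp
        (Homeomorph.measurableEmbedding _)]
      refine integral_congr_ae (ae_of_all _ fun x => ?_)
      have hx : 0 < ‖x.1‖ := norm_pos_iff.2 x.2
      have hfx := hf ‖x.1‖ hx (‖x.1‖⁻¹ • x.1)
      rw [smul_inv_smul₀ hx.ne'] at hfx
      simp only [homeomorphUnitSphereProd_apply_snd_coe, homeomorphUnitSphereProd_apply_fst_coe]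
      rw [hfx]
      ring
    _ = (∫ s : sphere (0 : E) 1, f s ∂μ.toSphere) *
          ∫ r : Set.Ioi (0 : ℝ), g r * (r : ℝ) ^ q ∂.volumeIoiPow (Module.finrank ℝ E - 1) :=
      integral_prod_mul (fun s : sphere (0 : E) 1 => f s)
        fun r : Set.Ioi (0 : ℝ) => g r * (r : ℝ) ^ q
    _ = _ := by
      simp only [Measure.volumeIoiPow, ENNReal.ofReal]
      rw [integral_withDensity_eq_integral_smul,
        integral_subtype_comap measurableSet_Ioi
          fun a : ℝ ↦ Real.toNNReal (a ^ (Module.finrank ℝ E - 1)) • (g a * a ^ q),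
        setIntegral_congr_fun measurableSet_Ioi fun x hx ↦ ?_]
      · simp only [NNReal.smul_def, smul_eq_mul]
        rw [Real.coe_toNNReal _ (pow_nonneg (le_of_lt hx) _)]
      · exact (measurable_subtype_coe.pow_const _).real_toNNReal

/-- The radial integral of a Gaussian weight of variance `1 / d`. -/
lemma integral_radial_gaussian {d : ℕ} (hd : 0 < d) {q : ℝ} (hq : 0 ≤ q) (c : ℝ) :
    ∫ r in Set.Ioi (0 : ℝ), r ^ (d - 1) *
        ((c * Real.exp (-r ^ 2 / (2 * ((1 / d : ℝ≥0) : ℝ)))) * r ^ q) =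
      c * ((2 / d : ℝ) ^ ((d : ℝ) / 2 + q / 2) * (1 / 2) * Real.Gamma (d / 2 + q / 2)) := by
  have hd' : (0 : ℝ) < d := by exact_mod_cast hd
  have hd1 : (1 : ℝ) ≤ d := by exact_mod_cast hd
  have key := integral_rpow_mul_exp_neg_mul_rpow (p := 2) (q := (d : ℝ) - 1 + q) (b := d / 2)
    (by norm_num) (by linarith) (by positivity)
  have hexp : ((d : ℝ) - 1 + q + 1) / 2 = d / 2 + q / 2 := by ring
  rw [neg_div, hexp, Real.rpow_neg (by positivity), ← Real.inv_rpow (by positivity), inv_div]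
    at key
  rw [← key, ← integral_const_mul]
  refine setIntegral_congr_fun measurableSet_Ioi fun r hr => ?_
  have hr' : (0 : ℝ) < r := hr
  have harg : -r ^ 2 / (2 * ((1 / d : ℝ≥0) : ℝ)) = -((d : ℝ) / 2) * r ^ (2 : ℝ) := by
    push_cast
    rw [Real.rpow_two]
    field_simp
  have hpow : r ^ (d - 1) = r ^ ((d : ℝ) - 1) := by
    rw [← Real.rpow_natCast, Nat.cast_sub hd, Nat.cast_one]
  rw [harg, hpow, Real.rpow_add hr']
  ring

/-- For a positively homogeneous function of degree `q`, the integral against `N(0, (1/d) I_d)`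
is an explicit multiple of the integral against the uniform measure on the sphere. -/
lemma integral_gaussianPi_of_homogeneous {d : ℕ} (hd : 0 < d) {q : ℝ} (hq : 0 ≤ q)
    (f : EuclideanSpace ℝ (Fin d) → ℝ)
    (hf : ∀ r : ℝ, 0 < r → ∀ x, f (r • x) = r ^ q * f x) :
    ∫ x, f x ∂(gaussianPi d 0 (1 / d)) =
      (2 / d : ℝ) ^ (q / 2) * (Real.Gamma (d / 2 + q / 2) / Real.Gamma (d / 2)) *
        ∫ s, f s ∂(sphereUniform d) := by
  have hd' : (0 : ℝ) < d := by exact_mod_cast hd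
  have : Nonempty (Fin d) := ⟨⟨0, hd⟩⟩
  have hv : (1 / d : ℝ≥0) ≠ 0 := by positivity
  set c : ℝ := (√(2 * Real.pi * ((1 / d : ℝ≥0) : ℝ)))⁻¹ ^ d
  have polar (q : ℝ) (hq : 0 ≤ q) (f : EuclideanSpace ℝ (Fin d) → ℝ)
      (hf : ∀ r : ℝ, 0 < r → ∀ x, f (r • x) = r ^ q * f x) :
      ∫ x, f x ∂(gaussianPi d 0 (1 / d)) =
        (∫ s : sphere (0 : EuclideanSpace ℝ (Fin d)) 1, f s ∂volume.toSphere) *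
          (c * ((2 / d : ℝ) ^ ((d : ℝ) / 2 + q / 2) * (1 / 2) *
            Real.Gamma (d / 2 + q / 2))) := by
    rw [integral_gaussianPi_zero d hv, integral_radial_mul_homogeneous volume
      (fun r => c * Real.exp (-r ^ 2 / (2 * ((1 / d : ℝ≥0) : ℝ)))) f q hf,
      finrank_euclideanSpace_fin, integral_radial_gaussian hd hq]
  have hprob : IsProbabilityMeasure (gaussianPi d 0 (1 / d)) :=
    Measure.isProbabilityMeasure_map
      (EuclideanSpace.equiv (Fin d) ℝ).symm.continuous.measurable.aemeasurable
  have hone := polar 0 le_rfl (fun _ => 1) (by simp)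
  simp only [integral_const, probReal_univ, smul_eq_mul, mul_one, zero_div, add_zero] at hone
  have hGamma : 0 < Real.Gamma ((d : ℝ) / 2) := Real.Gamma_pos_of_pos (by positivity)
  have htwo : 0 < (2 / d : ℝ) ^ ((d : ℝ) / 2) := by positivity
  rw [polar q hq f hf, sphereUniform, integral_smul_measure, ENNReal.toReal_inv, smul_eq_mul,
    ← measureReal_def, Real.rpow_add (by positivity)]
  set A := (volume : Measure (EuclideanSpace ℝ (Fin d))).toSphere.real Set.univ
  have hA : A ≠ 0 := by
    intro h
    simp [h] at hone
  have hcA : c = 2 / (A * (2 / d : ℝ) ^ ((d : ℝ) / 2) * Real.Gamma ((d : ℝ) / 2)) := by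
    field_simp
    linarith
  rw [hcA]
  field_simp

/-- Scaling a coupling by `r` multiplies its transport cost by `r ^ p`. -/
lemma WpPow_cost_scale {p r : ℝ} (hr : 0 < r) {μ ν : Measure ℝ} {c : ℝ}
    (hc : ∃ γ : Measure (ℝ × ℝ), IsProbabilityMeasure γ ∧
      γ.map Prod.fst = μ ∧ γ.map Prod.snd = ν ∧ c = ∫ z, |z.1 - z.2| ^ p ∂γ) :
    ∃ γ : Measure (ℝ × ℝ), IsProbabilityMeasure γ ∧
      γ.map Prod.fst = μ.map (r * ·) ∧ γ.map Prod.snd = ν.map (r * ·) ∧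
      r ^ p * c = ∫ z, |z.1 - z.2| ^ p ∂γ := by
  obtain ⟨γ, hγ, rfl, rfl, rfl⟩ := hc
  have hmeas : Measurable (fun z : ℝ × ℝ => (r * z.1, r * z.2)) := by fun_prop
  refine ⟨γ.map fun z => (r * z.1, r * z.2),
    Measure.isProbabilityMeasure_map hmeas.aemeasurable, ?_, ?_, ?_⟩
  · rw [Measure.map_map measurable_fst hmeas, Measure.map_map (by fun_prop) measurable_fst]
    rfl
  · rw [Measure.map_map measurable_snd hmeas, Measure.map_map (by fun_prop) measurable_snd]
    rfl
  · rw [integral_map hmeas.aemeasurable (by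
      have : Measurable fun z : ℝ × ℝ => |z.1 - z.2| ^ p := by fun_prop
      exact this.aestronglyMeasurable), ← integral_const_mul]
    refine integral_congr_ae (ae_of_all _ fun z => ?_)
    simp only
    rw [← mul_sub, abs_mul, abs_of_pos hr, Real.mul_rpow hr.le (abs_nonneg _)]

lemma WpPow_map_mul_left {p r : ℝ} (hr : 0 < r) (μ ν : Measure ℝ) :
    WpPow p (μ.map (r * ·)) (ν.map (r * ·)) = r ^ p * WpPow p μ ν := by
  have hrp : 0 < r ^ p := Real.rpow_pos_of_pos hr p
  have hinv (ρ : Measure ℝ) : (ρ.map (r * ·)).map (r⁻¹ * ·) = ρ := by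
    rw [Measure.map_map (by fun_prop) (by fun_prop)]
    convert Measure.map_id
    ext x
    simp [hr.ne']
  unfold WpPow
  rw [← smul_eq_mul, ← Real.sInf_smul_of_nonneg hrp.le]
  congr 1
  ext c
  rw [Set.mem_smul_set_iff_inv_smul_mem₀ hrp.ne']
  constructor
  · intro hc
    have := WpPow_cost_scale (inv_pos.2 hr) hc
    rwa [hinv, hinv, Real.inv_rpow hr.le] at this
  · intro hc
    have := WpPow_cost_scale hr hc
    rwa [smul_eq_mul, mul_inv_cancel_left₀ hrp.ne'] at this

lemma WpPow_nonneg (p : ℝ) (μ ν : Measure ℝ) : 0 ≤ WpPow p μ ν := by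
  refine Real.sInf_nonneg ?_
  rintro _ ⟨γ, -, -, -, rfl⟩
  exact integral_nonneg fun z => Real.rpow_nonneg (abs_nonneg _) p

theorem gaussian_sliced_wasserstein_eq (d : ℕ) (hd : 0 < d) (p : ℝ) (hp : 1 ≤ p)
    (μ ν : Measure (EuclideanSpace ℝ (Fin d)))
    [IsProbabilityMeasure μ] [IsProbabilityMeasure ν]
    (hμ : Integrable (fun x => ‖x‖ ^ p) μ) (hν : Integrable (fun x => ‖x‖ ^ p) ν) :
    (tSWPow p μ ν) ^ (1 / p)
      = Real.sqrt (2 / d) * (Real.Gamma (d / 2 + p / 2) / Real.Gamma (d / 2)) ^ (1 / p)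
          * (SWPow p μ ν) ^ (1 / p) := by
  have hp₀ : 0 < p := by linarith
  have hd' : (0 : ℝ) < d := by exact_mod_cast hd
  have hproj (ρ : Measure (EuclideanSpace ℝ (Fin d))) (r : ℝ) (θ : EuclideanSpace ℝ (Fin d)) :
      ρ.map (fun x => ⟪r • θ, x⟫) = (ρ.map fun x => ⟪θ, x⟫).map (r * ·) := by
    rw [Measure.map_map (by fun_prop) (by fun_prop)]
    congr 1
    ext x
    simp [real_inner_smul_left]
  have hpow : tSWPow p μ ν = (2 / d : ℝ) ^ (p / 2) *
      (Real.Gamma (d / 2 + p / 2) / Real.Gamma (d / 2)) * SWPow p μ ν := by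
    refine integral_gaussianPi_of_homogeneous hd hp₀.le
      (fun θ => WpPow p (μ.map fun x => ⟪θ, x⟫) (ν.map fun x => ⟪θ, x⟫)) fun r hr θ => ?_
    simp only [hproj]
    exact WpPow_map_mul_left hr _ _
  have hGamma : 0 ≤ Real.Gamma (d / 2 + p / 2) / Real.Gamma ((d : ℝ) / 2) :=
    div_nonneg (Real.Gamma_pos_of_pos (by positivity)).le
      (Real.Gamma_pos_of_pos (by positivity)).le
  have hSW : 0 ≤ SWPow p μ ν := integral_nonneg fun θ => WpPow_nonneg p _ _
  rw [hpow, Real.mul_rpow (by positivity) hSW, Real.mul_rpow (by positivity) hGamma,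
    ← Real.rpow_mul (by positivity), Real.sqrt_eq_rpow,
    show p / 2 * (1 / p) = 1 / 2 by field_simp]
end

section
/- For any $\mathbf{m}_1, \mathbf{m}_2 \in \mathbb{R}^d$ and $\sigma_1, \sigma_2 > 0$, the order-2 Sliced-Wasserstein distance between isotropic Gaussians satisfies $SW_2^2\big(\mathrm{N}(\mathbf{m}_1, \sigma_1^2 \mathbf{I}_d), \mathrm{N}(\mathbf{m}_2, \sigma_2^2 \mathbf{I}_d)\big) = \frac{1}{d}\|\mathbf{m}_1 - \mathbf{m}_2\|^2 + (\sigma_1 - \sigma_2)^2$. -/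
open MeasureTheory Metric ProbabilityTheory
open scoped RealInnerProductSpace NNReal

/-- A linear isometry equivalence, restricted to the unit sphere. -/
def LinearIsometryEquiv.sphereMap {E : Type*} [NormedAddCommGroup E] [NormedSpace ℝ E]
    (f : E ≃ₗᵢ[ℝ] E) (x : sphere (0 : E) 1) : sphere (0 : E) 1 :=
  ⟨f x, by simp⟩

theorem measurable_sphereMap {E : Type*} [NormedAddCommGroup E] [NormedSpace ℝ E]
    [MeasurableSpace E] [BorelSpace E] (f : E ≃ₗᵢ[ℝ] E) : Measurable f.sphereMap :=
  (f.continuous.measurable.comp measurable_subtype_coe).subtype_mk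

open scoped Pointwise in
theorem measurePreserving_sphereMap_toSphere {E : Type*} [NormedAddCommGroup E]
    [InnerProductSpace ℝ E] [FiniteDimensional ℝ E] [MeasurableSpace E] [BorelSpace E]
    (f : E ≃ₗᵢ[ℝ] E) :
    MeasurePreserving f.sphereMap (volume : Measure E).toSphere
      (volume : Measure E).toSphere := by
  refine ⟨measurable_sphereMap f, ?_⟩
  ext s hs
  rw [Measure.map_apply (measurable_sphereMap f) hs,
    Measure.toSphere_apply' _ (measurable_sphereMap f hs), Measure.toSphere_apply' _ hs,
    ← f.measurePreserving.measure_preimage_equiv (f := f.toMeasurableEquiv)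
      (Set.Ioo (0 : ℝ) 1 • (Subtype.val '' s))]
  congr 2
  ext x
  simp only [Set.mem_smul, Set.mem_image, Set.mem_preimage]
  constructor
  · rintro ⟨r, hr, _, ⟨y, hy, rfl⟩, rfl⟩
    exact ⟨r, hr, _, ⟨_, hy, rfl⟩, (f.map_smul r y).symm⟩
  · rintro ⟨r, hr, _, ⟨y, hy, rfl⟩, h⟩
    refine ⟨r, hr, _, ⟨f.symm.sphereMap y, ?_, rfl⟩, ?_⟩
    · convert hy
      ext1
      exact f.apply_symm_apply _
    · apply f.injective
      simpa [LinearIsometryEquiv.sphereMap] using h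

theorem isProbabilityMeasure_sphereUniform {d : ℕ} (hd : 0 < d) :
    IsProbabilityMeasure (sphereUniform d) := by
  have : Nonempty (Fin d) := ⟨⟨0, hd⟩⟩
  refine ⟨?_⟩
  rw [sphereUniform, Measure.smul_apply, smul_eq_mul]
  exact ENNReal.inv_mul_cancel (Measure.measure_univ_ne_zero.2 (Measure.toSphere_ne_zero _))
    (measure_ne_top _ _)

theorem measurePreserving_sphereMap_sphereUniform {d : ℕ}
    (f : EuclideanSpace ℝ (Fin d) ≃ₗᵢ[ℝ] EuclideanSpace ℝ (Fin d)) :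
    MeasurePreserving f.sphereMap (sphereUniform d) (sphereUniform d) :=
  (measurePreserving_sphereMap_toSphere f).smul_measure _

theorem integral_inner_sq_sphereUniform_eq_of_norm_eq {d : ℕ}
    {v w : EuclideanSpace ℝ (Fin d)} (h : ‖v‖ = ‖w‖) :
    ∫ θ : sphere (0 : EuclideanSpace ℝ (Fin d)) 1,
        ⟪(θ : EuclideanSpace ℝ (Fin d)), v⟫ ^ 2 ∂(sphereUniform d) =
      ∫ θ : sphere (0 : EuclideanSpace ℝ (Fin d)) 1,
        ⟪(θ : EuclideanSpace ℝ (Fin d)), w⟫ ^ 2 ∂(sphereUniform d) := by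
  set f := (ℝ ∙ (v - w))ᗮ.reflection
  have hf : f v = w := Submodule.reflection_sub h
  have hm := measurePreserving_sphereMap_sphereUniform f
  conv_rhs => rw [← hm.map_eq]
  rw [integral_map hm.measurable.aemeasurable (by fun_prop)]
  simp_rw [← hf]
  simp [LinearIsometryEquiv.sphereMap]

theorem integrable_inner_sq_sphereUniform {d : ℕ} (hd : 0 < d)
    (v : EuclideanSpace ℝ (Fin d)) :
    Integrable (fun θ : sphere (0 : EuclideanSpace ℝ (Fin d)) 1 =>
      ⟪(θ : EuclideanSpace ℝ (Fin d)), v⟫ ^ 2) (sphereUniform d) := by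
  have := isProbabilityMeasure_sphereUniform hd
  exact Continuous.integrable_of_hasCompactSupport (by fun_prop) (.of_compactSpace _)

theorem integral_inner_sq_sphereUniform {d : ℕ} (hd : 0 < d)
    (v : EuclideanSpace ℝ (Fin d)) :
    ∫ θ : sphere (0 : EuclideanSpace ℝ (Fin d)) 1,
        ⟪(θ : EuclideanSpace ℝ (Fin d)), v⟫ ^ 2 ∂(sphereUniform d) = (1 / d) * ‖v‖ ^ 2 := by
  have := isProbabilityMeasure_sphereUniform hd
  have hcoord (i : Fin d) : ∫ θ : sphere (0 : EuclideanSpace ℝ (Fin d)) 1,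
      ⟪(θ : EuclideanSpace ℝ (Fin d)), v⟫ ^ 2 ∂(sphereUniform d) =
        ‖v‖ ^ 2 * ∫ θ : sphere (0 : EuclideanSpace ℝ (Fin d)) 1,
          ⟪(θ : EuclideanSpace ℝ (Fin d)), EuclideanSpace.single i 1⟫ ^ 2 ∂(sphereUniform d) := by
    rw [integral_inner_sq_sphereUniform_eq_of_norm_eq (w := ‖v‖ • EuclideanSpace.single i 1)
      (by simp [norm_smul]), ← integral_const_mul]
    simp_rw [real_inner_smul_right, mul_pow]
  have hsum : ∑ i : Fin d, ∫ θ : sphere (0 : EuclideanSpace ℝ (Fin d)) 1,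
      ⟪(θ : EuclideanSpace ℝ (Fin d)), EuclideanSpace.single i 1⟫ ^ 2 ∂(sphereUniform d) = 1 := by
    rw [← integral_finsetSum _ fun i _ => integrable_inner_sq_sphereUniform hd _]
    have hone (θ : sphere (0 : EuclideanSpace ℝ (Fin d)) 1) :
        ∑ i, ⟪(θ : EuclideanSpace ℝ (Fin d)), EuclideanSpace.single i 1⟫ ^ 2 = 1 := by
      have := EuclideanSpace.real_norm_sq_eq (θ : EuclideanSpace ℝ (Fin d))
      rw [norm_eq_of_mem_sphere, one_pow] at this
      simpa [EuclideanSpace.inner_single_right] using this.symm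
    simp [hone]
  have h := Finset.sum_congr rfl fun (i : Fin d) (_ : i ∈ Finset.univ) => hcoord i
  rw [← Finset.mul_sum, hsum, Finset.sum_const, Finset.card_fin, nsmul_eq_mul, mul_one] at h
  have hd' : (d : ℝ) ≠ 0 := by positivity
  field_simp
  linarith

theorem map_inner_gaussianPi {d : ℕ} (m : EuclideanSpace ℝ (Fin d)) (v : ℝ≥0)
    (θ : sphere (0 : EuclideanSpace ℝ (Fin d)) 1) :
    (gaussianPi d (fun i => m i) v).map (fun x => ⟪(θ : EuclideanSpace ℝ (Fin d)), x⟫) =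
      gaussianReal ⟪(θ : EuclideanSpace ℝ (Fin d)), m⟫ v := by
  have hθ := EuclideanSpace.real_norm_sq_eq (θ : EuclideanSpace ℝ (Fin d))
  rw [norm_eq_of_mem_sphere, one_pow] at hθ
  have hmeas : Measurable fun x : Fin d → ℝ =>
      ⟪(θ : EuclideanSpace ℝ (Fin d)), (EuclideanSpace.equiv (Fin d) ℝ).symm x⟫ := by
    fun_prop
  rw [gaussianPi, Measure.map_map (by fun_prop) (by fun_prop)]
  change Measure.map (fun x : Fin d → ℝ =>
    ⟪(θ : EuclideanSpace ℝ (Fin d)), (EuclideanSpace.equiv (Fin d) ℝ).symm x⟫) _ = _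
  have := Measure.isProbabilityMeasure_map
    (μ := Measure.pi fun i => gaussianReal (m i) v) hmeas.aemeasurable
  apply Measure.ext_of_charFun
  ext t
  rw [charFun_apply_real, integral_map hmeas.aemeasurable (by fun_prop), charFun_gaussianReal]
  have hprod (x : Fin d → ℝ) :
      Complex.exp (t * (⟪(θ : EuclideanSpace ℝ (Fin d)),
        (EuclideanSpace.equiv (Fin d) ℝ).symm x⟫ : ℝ) * Complex.I) =
      ∏ i, Complex.exp ((t * (θ : EuclideanSpace ℝ (Fin d)) i : ℝ) * x i * Complex.I) := by
    rw [← Complex.exp_sum, ← Finset.sum_mul]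
    congr 2
    simp only [PiLp.inner_apply, Complex.ofReal_sum, Finset.mul_sum]
    refine Finset.sum_congr rfl fun i _ => ?_
    simp
    ring
  simp_rw [hprod]
  rw [integral_fintype_prod_eq_prod (μ := fun i => gaussianReal (m i) v) (𝕜 := ℂ)
    (fun i (y : ℝ) => Complex.exp ((t * (θ : EuclideanSpace ℝ (Fin d)) i : ℝ) * y * Complex.I))]
  simp_rw [← charFun_apply_real, charFun_gaussianReal]
  rw [← Complex.exp_sum, Finset.sum_sub_distrib]
  congr 2
  · rw [← Finset.sum_mul]
    simp only [PiLp.inner_apply, Complex.ofReal_sum, Finset.mul_sum]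
    congr 1
    refine Finset.sum_congr rfl fun i _ => ?_
    simp
    ring
  · have : (∑ i, ((θ : EuclideanSpace ℝ (Fin d)) i : ℂ) ^ 2) = 1 := by exact_mod_cast hθ.symm
    rw [← mul_one ((v : ℂ) * t ^ 2 / 2), ← mul_div_right_comm, ← this, Finset.mul_sum,
      Finset.sum_div]
    refine Finset.sum_congr rfl fun i _ => ?_
    push_cast
    ring

theorem integral_sub_sq_gaussianReal (a : ℝ) (v : ℝ≥0) :
    ∫ x, (x - a) ^ 2 ∂(gaussianReal a v) = v := by
  have := variance_id_gaussianReal (μ := a) (v := v)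
  simpa [variance_eq_integral aemeasurable_id] using this

theorem add_sq_le_integral_of_coupling_gaussianReal {a b s t : ℝ} (hs : 0 < s) (ht : 0 < t)
    {γ : Measure (ℝ × ℝ)} [IsProbabilityMeasure γ]
    (h₁ : γ.map Prod.fst = gaussianReal a (s ^ 2).toNNReal)
    (h₂ : γ.map Prod.snd = gaussianReal b (t ^ 2).toNNReal) :
    (a - b) ^ 2 + (s - t) ^ 2 ≤ ∫ z, (z.1 - z.2) ^ 2 ∂γ := by
  have hfst : MeasurePreserving Prod.fst γ (gaussianReal a (s ^ 2).toNNReal) :=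
    ⟨measurable_fst, h₁⟩
  have hsnd : MeasurePreserving Prod.snd γ (gaussianReal b (t ^ 2).toNNReal) :=
    ⟨measurable_snd, h₂⟩
  have hX : MemLp (fun z : ℝ × ℝ => z.1) 2 γ :=
    (memLp_id_gaussianReal 2).comp_measurePreserving hfst
  have hY : MemLp (fun z : ℝ × ℝ => z.2) 2 γ :=
    (memLp_id_gaussianReal 2).comp_measurePreserving hsnd
  have hU : MemLp (fun z : ℝ × ℝ => z.1 - a) 2 γ := hX.sub (memLp_const a)
  have hV : MemLp (fun z : ℝ × ℝ => z.2 - b) 2 γ := hY.sub (memLp_const b)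
  have iU := hU.integrable one_le_two
  have iV := hV.integrable one_le_two
  have eU : ∫ z, (z.1 - a) ∂γ = 0 := by
    rw [integral_sub (hX.integrable one_le_two) (integrable_const a),
      ← integral_map (f := fun x : ℝ => x) measurable_fst.aemeasurable (by fun_prop), h₁]
    simp
  have eV : ∫ z, (z.2 - b) ∂γ = 0 := by
    rw [integral_sub (hY.integrable one_le_two) (integrable_const b),
      ← integral_map (f := fun x : ℝ => x) measurable_snd.aemeasurable (by fun_prop), h₂]
    simp
  have eU2 : ∫ z, (z.1 - a) ^ 2 ∂γ = s ^ 2 := by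
    rw [← integral_map (f := fun x : ℝ => (x - a) ^ 2) measurable_fst.aemeasurable
      (by fun_prop), h₁, integral_sub_sq_gaussianReal, Real.coe_toNNReal _ (sq_nonneg s)]
  have eV2 : ∫ z, (z.2 - b) ^ 2 ∂γ = t ^ 2 := by
    rw [← integral_map (f := fun x : ℝ => (x - b) ^ 2) measurable_snd.aemeasurable
      (by fun_prop), h₂, integral_sub_sq_gaussianReal, Real.coe_toNNReal _ (sq_nonneg t)]
  have i₁ : Integrable (fun z : ℝ × ℝ => 2 * (a - b) * ((z.1 - a) - (z.2 - b))) γ :=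
    (iU.sub iV).const_mul (2 * (a - b))
  have i₂ : Integrable
      (fun z : ℝ × ℝ => (a - b) ^ 2 + 2 * (a - b) * ((z.1 - a) - (z.2 - b))) γ :=
    (integrable_const _).add i₁
  have i₃ := hU.integrable_sq.const_mul (1 - t / s)
  have i₄ := hV.integrable_sq.const_mul (1 - s / t)
  have i₂₃ : Integrable (fun z : ℝ × ℝ => (a - b) ^ 2 + 2 * (a - b) * ((z.1 - a) - (z.2 - b))
      + (1 - t / s) * (z.1 - a) ^ 2) γ := i₂.add i₃
  calc (a - b) ^ 2 + (s - t) ^ 2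
      = ∫ z, ((a - b) ^ 2 + 2 * (a - b) * ((z.1 - a) - (z.2 - b))
          + (1 - t / s) * (z.1 - a) ^ 2 + (1 - s / t) * (z.2 - b) ^ 2) ∂γ := by
        rw [integral_add i₂₃ i₄, integral_add i₂ i₃, integral_add (integrable_const _) i₁,
          integral_const_mul, integral_const_mul, integral_const_mul, integral_sub iU iV,
          eU, eV, eU2, eV2]
        simp
        field_simp
        ring
    _ ≤ ∫ z, (z.1 - z.2) ^ 2 ∂γ := by
        refine integral_mono (i₂₃.add i₄) (hX.sub hY).integrable_sq fun z => ?_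
        have key : 0 ≤ (t * (z.1 - a) - s * (z.2 - b)) ^ 2 / (s * t) := by positivity
        have expand : (t * (z.1 - a) - s * (z.2 - b)) ^ 2 / (s * t) =
            t / s * (z.1 - a) ^ 2 + s / t * (z.2 - b) ^ 2 - 2 * (z.1 - a) * (z.2 - b) := by
          field_simp
          ring
        rw [expand] at key
        simp only
        linarith

theorem map_affine_gaussianReal (a s : ℝ) :
    (gaussianReal 0 1).map (fun x => a + s * x) = gaussianReal a (s ^ 2).toNNReal := by
  have : (fun x : ℝ => a + s * x) = (a + ·) ∘ (s * ·) := rfl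
  rw [this, ← Measure.map_map (by fun_prop) (by fun_prop), gaussianReal_map_const_mul,
    gaussianReal_map_const_add]
  congr 1
  · simp
  · ext
    simp [sq_nonneg]

theorem WpPow_two_gaussianReal (a b : ℝ) {s t : ℝ} (hs : 0 < s) (ht : 0 < t) :
    WpPow 2 (gaussianReal a (s ^ 2).toNNReal) (gaussianReal b (t ^ 2).toNNReal) =
      (a - b) ^ 2 + (s - t) ^ 2 := by
  refine IsLeast.csInf_eq ⟨?_, ?_⟩
  · have hm : Measurable fun x : ℝ => (a + s * x, b + t * x) := by fun_prop
    refine ⟨(gaussianReal 0 1).map fun x => (a + s * x, b + t * x),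
      Measure.isProbabilityMeasure_map hm.aemeasurable, ?_, ?_, ?_⟩
    · rw [Measure.map_map measurable_fst hm]
      exact map_affine_gaussianReal a s
    · rw [Measure.map_map measurable_snd hm]
      exact map_affine_gaussianReal b t
    · simp_rw [Real.rpow_two, sq_abs]
      rw [integral_map hm.aemeasurable (by fun_prop)]
      have hid : MemLp (fun x : ℝ => x) 2 (gaussianReal 0 1) := memLp_id_gaussianReal 2
      have hsq : ∫ x, x ^ 2 ∂(gaussianReal 0 1) = 1 := by
        simpa using integral_sub_sq_gaussianReal 0 1
      have i₁ := (hid.integrable one_le_two).const_mul (2 * (a - b) * (s - t))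
      have i₂ := hid.integrable_sq.const_mul ((s - t) ^ 2)
      have i₀₁ : Integrable (fun x : ℝ => (a - b) ^ 2 + 2 * (a - b) * (s - t) * x)
          (gaussianReal 0 1) := (integrable_const _).add i₁
      have hexp (x : ℝ) : (a + s * x - (b + t * x)) ^ 2 =
          (a - b) ^ 2 + 2 * (a - b) * (s - t) * x + (s - t) ^ 2 * x ^ 2 := by ring
      simp_rw [hexp]
      rw [integral_add i₀₁ i₂, integral_add (integrable_const _) i₁,
        integral_const_mul, integral_const_mul, hsq, integral_id_gaussianReal]
      simp
  · rintro _ ⟨γ, _, h₁, h₂, rfl⟩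
    simp_rw [Real.rpow_two, sq_abs]
    exact add_sq_le_integral_of_coupling_gaussianReal hs ht h₁ h₂

theorem sliced_wasserstein_isotropic_gaussians {d : ℕ} (hd : 0 < d)
    (m₁ m₂ : EuclideanSpace ℝ (Fin d)) (σ₁ σ₂ : ℝ) (hσ₁ : 0 < σ₁) (hσ₂ : 0 < σ₂) :
    SWPow 2 (gaussianPi d (fun i => m₁ i) (σ₁ ^ 2).toNNReal)
        (gaussianPi d (fun i => m₂ i) (σ₂ ^ 2).toNNReal)
      = (1 / d) * ‖m₁ - m₂‖ ^ 2 + (σ₁ - σ₂) ^ 2 := by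
  have := isProbabilityMeasure_sphereUniform hd
  simp_rw [SWPow, map_inner_gaussianPi, WpPow_two_gaussianReal _ _ hσ₁ hσ₂, ← inner_sub_right]
  rw [integral_add (integrable_inner_sq_sphereUniform hd _) (integrable_const _),
    integral_inner_sq_sphereUniform hd]
  simp
end
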